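/- Let B = (b_{iℓ}) be an n×2 integer matrix of rank 2 with both column sums equal to zero, with rows b_1, …, b_n ∈ ℤ². In ℚ[x_1, …, x_n][t], define for ℓ = 1, 2 the polynomials h_ℓ(t) = ∏_{i : b_{iℓ} > 0} (b_{i1} + b_{i2}·t)^{b_{iℓ}}·x_i^{b_{iℓ}} − ∏_{i : b_{iℓ} < 0} (b_{i1} + b_{i2}·t)^{−b_{iℓ}}·x_i^{−b_{iℓ}}. Then h_1 and h_2 have a nonconstant common factor as polynomials in t over the field of fractions of ℚ[x_1, …, x_n] if and only if there exist indices r, s and a vector v ∈ ℤ² with both coordinates nonzero such that b_r is a positive rational multiple of v and b_s is a negative rational multiple of v (i.e. there is a relevant line which is not a coordinate axis). -/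

import Mathlib

open Polynomial

/-- For an `n × 2` integer matrix `B`, the polynomial
`h_ℓ(t) = ∏_{i : b_{iℓ} > 0} (b_{i1} + b_{i2}·t)^{b_{iℓ}}·x_i^{b_{iℓ}}
        − ∏_{i : b_{iℓ} < 0} (b_{i1} + b_{i2}·t)^{−b_{iℓ}}·x_i^{−b_{iℓ}}`
with coefficients in `ℚ[x_1, …, x_n]`. -/
noncomputable def specH {n : ℕ} (B : Matrix (Fin n) (Fin 2) ℤ) (ℓ : Fin 2) :
    Polynomial (MvPolynomial (Fin n) ℚ) :=
  (∏ i ∈ Finset.univ.filter fun i => 0 < B i ℓ,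
      ((C (MvPolynomial.C ((B i 0 : ℚ))) + C (MvPolynomial.C ((B i 1 : ℚ))) * X) *
        C (MvPolynomial.X i)) ^ (B i ℓ).toNat) -
  (∏ i ∈ Finset.univ.filter fun i => B i ℓ < 0,
      ((C (MvPolynomial.C ((B i 0 : ℚ))) + C (MvPolynomial.C ((B i 1 : ℚ))) * X) *
        C (MvPolynomial.X i)) ^ (-(B i ℓ)).toNat)

/-- If two products of powers, split according to the sign of the exponents, agree, then either
the product of integer powers is `1`, or a base vanishes on each side. -/
lemma prod_zpow_eq_one_or_exists_eq_zero {ι L : Type*} [Fintype ι] [Field L] (y : ι → L)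
    (b : ι → ℤ)
    (h : ∏ i ∈ Finset.univ.filter fun i => 0 < b i, y i ^ (b i).toNat =
      ∏ i ∈ Finset.univ.filter fun i => b i < 0, y i ^ (-(b i)).toNat) :
    ∏ i, y i ^ b i = 1 ∨ ∃ r s, 0 < b r ∧ b s < 0 ∧ y r = 0 ∧ y s = 0 := by
  by_cases h0 : ∃ i, b i ≠ 0 ∧ y i = 0
  · right
    obtain ⟨i, hi, hyi⟩ := h0
    have hzero : ∏ i ∈ Finset.univ.filter fun i => 0 < b i, y i ^ (b i).toNat = 0 := by
      rcases lt_or_gt_of_ne hi with hneg | hpos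
      · rw [h]
        exact Finset.prod_eq_zero (i := i) (by simpa using hneg) (by rw [hyi, zero_pow (by omega)])
      · exact Finset.prod_eq_zero (i := i) (by simpa using hpos) (by rw [hyi, zero_pow (by omega)])
    have hzero' := h ▸ hzero
    obtain ⟨r, hr, hr0⟩ := Finset.prod_eq_zero_iff.1 hzero
    obtain ⟨s, hs, hs0⟩ := Finset.prod_eq_zero_iff.1 hzero'
    exact ⟨r, s, by simpa using hr, by simpa using hs, eq_zero_of_pow_eq_zero hr0,
      eq_zero_of_pow_eq_zero hs0⟩
  · left
    push Not at h0
    have hp : ∏ i ∈ Finset.univ.filter fun i => 0 < b i, y i ^ (b i).toNat =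
        ∏ i, y i ^ (b i).toNat := by
      refine Finset.prod_filter_of_ne fun i _ hi => ?_
      by_contra hb
      exact hi (by rw [Int.toNat_of_nonpos (by omega), pow_zero])
    have hn : ∏ i ∈ Finset.univ.filter fun i => b i < 0, y i ^ (-(b i)).toNat =
        ∏ i, y i ^ (-(b i)).toNat := by
      refine Finset.prod_filter_of_ne fun i _ hi => ?_
      by_contra hb
      exact hi (by rw [Int.toNat_of_nonpos (by omega), pow_zero])
    rw [hp, hn] at h
    have hterm : ∀ i, y i ^ b i = y i ^ (b i).toNat / y i ^ (-(b i)).toNat := by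
      intro i
      rcases eq_or_ne (b i) 0 with hb | hb
      · simp [hb]
      · rw [← zpow_natCast, ← zpow_natCast, ← zpow_sub₀ (h0 i hb)]
        congr 1
        omega
    rw [Finset.prod_congr rfl fun i _ => hterm i, Finset.prod_div_distrib, h]
    refine div_self (Finset.prod_ne_zero_iff.2 fun i _ => ?_)
    rcases eq_or_ne (b i) 0 with hb | hb
    · simp [hb]
    · exact pow_ne_zero _ (h0 i hb)

/-- The Laurent monomials in algebraically independent elements are linearly independent. -/
lemma AlgebraicIndependent.linearIndependent_prod_zpow {ι k L : Type*} [Fintype ι] [Field k]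
    [Field L] [Algebra k L] {x : ι → L} (hx : AlgebraicIndependent k x) :
    LinearIndependent k fun e : ι → ℤ => ∏ i, x i ^ e i := by
  classical
  rw [linearIndependent_iff']
  intro s g hg e₀ he₀
  have hx0 : ∀ i, x i ≠ 0 := fun i => hx.ne_zero i
  let N : ℤ := ∑ e ∈ s, ∑ i, |e i|
  have hN : ∀ e ∈ s, ∀ i, 0 ≤ N + e i := by
    intro e he i
    have h1 : |e i| ≤ ∑ i, |e i| :=
      Finset.single_le_sum (f := fun i => |e i|) (fun _ _ => abs_nonneg _) (Finset.mem_univ i)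
    have h2 : ∑ i, |e i| ≤ N :=
      Finset.single_le_sum (f := fun e : ι → ℤ => ∑ i, |e i|)
        (fun _ _ => Finset.sum_nonneg fun _ _ => abs_nonneg _) he
    have h3 := neg_abs_le (e i)
    linarith
  let m : (ι → ℤ) → ι →₀ ℕ := fun e => Finsupp.equivFunOnFinite.symm fun i => (N + e i).toNat
  have hm : ∀ e ∈ s, m e = m e₀ → e = e₀ := by
    intro e he h
    funext i
    have h1 : (N + e i).toNat = (N + e₀ i).toNat := DFunLike.congr_fun h i
    have h2 := hN e he i
    have h3 := hN e₀ he₀ i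
    omega
  let p : MvPolynomial ι k := ∑ e ∈ s, MvPolynomial.monomial (m e) (g e)
  have hp : MvPolynomial.aeval x p = 0 := by
    have : MvPolynomial.aeval x p = (∏ i, x i ^ N) * ∑ e ∈ s, g e • ∏ i, x i ^ e i := by
      simp only [p, map_sum, Finset.mul_sum]
      refine Finset.sum_congr rfl fun e he => ?_
      rw [MvPolynomial.aeval_monomial, Finsupp.prod_fintype _ _ (fun _ => pow_zero _),
        Algebra.smul_def, mul_left_comm, ← Finset.prod_mul_distrib]
      congr 1
      refine Finset.prod_congr rfl fun i _ => ?_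
      rw [← zpow_add₀ (hx0 i), ← zpow_natCast]
      congr 1
      exact Int.toNat_of_nonneg (hN e he i)
    rw [this, hg, mul_zero]
  have hp0 : p = 0 := hx.eq_zero_of_aeval_eq_zero p hp
  have hc : p.coeff (m e₀) = g e₀ := by
    simp only [p, MvPolynomial.coeff_sum, MvPolynomial.coeff_monomial]
    rw [Finset.sum_eq_single_of_mem e₀ he₀ fun e he hne => if_neg fun h => hne (hm e he h),
      if_pos rfl]
  rw [← hc, hp0, MvPolynomial.coeff_zero]

/-- Laurent monomials with linearly independent exponents in algebraically independent elements
are algebraically independent. -/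
lemma AlgebraicIndependent.prod_zpow {ι κ k L : Type*} [Fintype ι] [Fintype κ] [Field k]
    [Field L] [Algebra k L] {x : ι → L} (hx : AlgebraicIndependent k x) (B : Matrix ι κ ℤ)
    (hB : Function.Injective B.mulVec) :
    AlgebraicIndependent k fun j => ∏ i, x i ^ B i j := by
  rw [algebraicIndependent_iff]
  intro p hp
  have hinj : Function.Injective fun m : κ →₀ ℕ => B.mulVec fun j => (m j : ℤ) := by
    intro m m' h
    ext j
    exact_mod_cast congrFun (hB h) j
  have hli := hx.linearIndependent_prod_zpow.comp _ hinj
  rw [linearIndependent_iff'] at hli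
  have hx0 : ∀ i, x i ≠ 0 := fun i => hx.ne_zero i
  have hsum : ∑ m ∈ p.support, p.coeff m •
      ∏ i, x i ^ (B.mulVec fun j => (m j : ℤ)) i = 0 := by
    rw [← hp, MvPolynomial.aeval_def, MvPolynomial.eval₂_eq']
    refine Finset.sum_congr rfl fun m _ => ?_
    rw [Algebra.smul_def]
    congr 1
    simp only [← Finset.prod_pow]
    rw [Finset.prod_comm]
    refine Finset.prod_congr rfl fun i _ => ?_
    rw [Matrix.mulVec, dotProduct]
    induction (Finset.univ : Finset κ) using Finset.cons_induction with
    | empty => simp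
    | cons j t hj ih => rw [Finset.sum_cons, Finset.prod_cons, zpow_add₀ (hx0 i), ih, zpow_mul,
        zpow_natCast]
  ext m
  by_cases hm : m ∈ p.support
  · simpa using hli p.support (fun m => p.coeff m) hsum m hm
  · simpa using hm

open scoped IntermediateField.algebraAdjoinAdjoin in
/-- Two algebraically independent elements cannot both lie in a simple extension. -/
lemma AlgebraicIndependent.not_forall_mem_adjoin_singleton {k L : Type*} [Field k] [Field L]
    [Algebra k L] {z : Fin 2 → L} (hz : AlgebraicIndependent k z) (a : L) :
    ¬ ∀ j, z j ∈ IntermediateField.adjoin k {a} := by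
  intro hmem
  let z' : Fin 2 → IntermediateField.adjoin k {a} := fun j => ⟨z j, hmem j⟩
  have hz' : AlgebraicIndependent k z' :=
    AlgebraicIndependent.of_comp (IntermediateField.adjoin k {a}).val hz
  have h2 := hz'.lift_cardinalMk_le_trdeg
  have hA : Algebra.trdeg k (Algebra.adjoin k {a}) ≤ 1 := by
    have hspan : Algebra.adjoin k
        {(⟨a, Algebra.self_mem_adjoin_singleton k a⟩ : Algebra.adjoin k {a})} = ⊤ := by
      convert Algebra.adjoin_adjoin_coe_preimage (R := k) (s := {a})
      ext x
      simp [Subtype.ext_iff]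
    have : Algebra.IsAlgebraic (Algebra.adjoin k
        {(⟨a, Algebra.self_mem_adjoin_singleton k a⟩ : Algebra.adjoin k {a})})
        (Algebra.adjoin k {a}) := by
      refine ⟨fun x => ?_⟩
      exact isAlgebraic_algebraMap (⟨x, hspan ▸ Algebra.mem_top⟩ : Algebra.adjoin k
        {(⟨a, Algebra.self_mem_adjoin_singleton k a⟩ : Algebra.adjoin k {a})})
    simpa using Algebra.IsAlgebraic.trdeg_le_cardinalMk k
      {(⟨a, Algebra.self_mem_adjoin_singleton k a⟩ : Algebra.adjoin k {a})}
  have hE : Algebra.trdeg k (IntermediateField.adjoin k {a}) ≤ 1 := by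
    rw [← trdeg_add_eq k (Algebra.adjoin k {a}),
      trdeg_eq_zero (R := Algebra.adjoin k {a}), add_zero]
    exact hA
  have h3 := h2.trans (Cardinal.lift_le.2 hE)
  simp at h3

/-- A matrix over a Noetherian domain with full column rank acts injectively. -/
lemma Matrix.mulVec_injective_of_rank_eq {m n R : Type*} [Fintype m] [Fintype n] [CommRing R]
    [IsDomain R] [IsNoetherianRing R] (B : Matrix m n R) (h : B.rank = Fintype.card n) :
    Function.Injective B.mulVec := by
  have h1 := (LinearMap.ker B.mulVecLin).finrank_quotient_add_finrank
  rw [B.mulVecLin.quotKerEquivRange.finrank_eq, Module.finrank_pi] at h1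
  have h2 : Module.finrank R (LinearMap.ker B.mulVecLin) = 0 := by
    rw [Matrix.rank] at h
    omega
  rw [← Matrix.coe_mulVecLin, ← LinearMap.ker_eq_bot, ← Submodule.subsingleton_iff_eq_bot]
  by_contra hn
  rw [not_subsingleton_iff_nontrivial] at hn
  exact (Module.finrank_pos (R := R)).ne' h2

/-- Evaluation of the specialized polynomials at a point of an extension field. -/
lemma eval₂_specH {n : ℕ} {L : Type*} [Field L] [Algebra ℚ L] (B : Matrix (Fin n) (Fin 2) ℤ)
    (ℓ : Fin 2) (f : MvPolynomial (Fin n) ℚ →ₐ[ℚ] L) (a : L) :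
    (specH B ℓ).eval₂ (f : MvPolynomial (Fin n) ℚ →+* L) a =
      (∏ i ∈ Finset.univ.filter fun i => 0 < B i ℓ,
        (((B i 0 : L) + B i 1 * a) * f (MvPolynomial.X i)) ^ (B i ℓ).toNat) -
      ∏ i ∈ Finset.univ.filter fun i => B i ℓ < 0,
        (((B i 0 : L) + B i 1 * a) * f (MvPolynomial.X i)) ^ (-(B i ℓ)).toNat := by
  have hC : ∀ z : ℤ, f (MvPolynomial.C (z : ℚ)) = (z : L) := fun z => by simp
  simp only [specH, eval₂_sub, eval₂_finsetProd, eval₂_pow, eval₂_mul, eval₂_add, eval₂_C, eval₂_X,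
    RingHom.coe_coe, hC]

/-- A linear form attached to rows of opposite sign divides the specialized polynomial. -/
lemma linear_dvd_specH {n : ℕ} (B : Matrix (Fin n) (Fin 2) ℤ) (ℓ : Fin 2)
    (p : Polynomial (MvPolynomial (Fin n) ℚ)) {r s : Fin n} (hr : 0 < B r ℓ) (hs : B s ℓ < 0)
    (hpr : p ∣ C (MvPolynomial.C (B r 0 : ℚ)) + C (MvPolynomial.C (B r 1 : ℚ)) * X)
    (hps : p ∣ C (MvPolynomial.C (B s 0 : ℚ)) + C (MvPolynomial.C (B s 1 : ℚ)) * X) :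
    p ∣ specH B ℓ := by
  refine dvd_sub ?_ ?_
  · exact ((hpr.mul_right _).trans (dvd_pow_self _ (by omega))).trans
      (Finset.dvd_prod_of_mem (fun i => ((C (MvPolynomial.C ((B i 0 : ℚ))) +
        C (MvPolynomial.C ((B i 1 : ℚ))) * X) * C (MvPolynomial.X i)) ^ (B i ℓ).toNat)
        (by simpa using hr))
  · exact ((hps.mul_right _).trans (dvd_pow_self _ (by omega))).trans
      (Finset.dvd_prod_of_mem (fun i => ((C (MvPolynomial.C ((B i 0 : ℚ))) +
        C (MvPolynomial.C ((B i 1 : ℚ))) * X) * C (MvPolynomial.X i)) ^ (-(B i ℓ)).toNat)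
        (by simpa using hs))

/-- If the linear forms of two rows have a common zero, and the rows have opposite signs in a
column, then they are opposite multiples of a vector without zero coordinates. -/
lemma exists_opposite_of_common_zero {n : ℕ} {L : Type*} [Field L] [CharZero L]
    (B : Matrix (Fin n) (Fin 2) ℤ) (ℓ : Fin 2) {r s : Fin n} (a : L)
    (hr : 0 < B r ℓ) (hs : B s ℓ < 0) (hr0 : B r 0 ≠ 0) (hr1 : B r 1 ≠ 0)
    (hra : (B r 0 : L) + B r 1 * a = 0) (hsa : (B s 0 : L) + B s 1 * a = 0) :
    ∃ (r s : Fin n) (v : ℤ × ℤ), v.1 ≠ 0 ∧ v.2 ≠ 0 ∧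
      (∃ p : ℚ, 0 < p ∧ (B r 0 : ℚ) = p * (v.1 : ℚ) ∧ (B r 1 : ℚ) = p * (v.2 : ℚ)) ∧
      (∃ q : ℚ, q < 0 ∧ (B s 0 : ℚ) = q * (v.1 : ℚ) ∧ (B s 1 : ℚ) = q * (v.2 : ℚ)) := by
  have hdet : (B r 0 : ℚ) * B s 1 = B s 0 * B r 1 := by
    have : (B r 0 : L) * B s 1 = B s 0 * B r 1 := by
      linear_combination (B s 1 : L) * hra - (B r 1 : L) * hsa
    exact_mod_cast this
  have hr0' : (B r 0 : ℚ) ≠ 0 := by exact_mod_cast hr0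
  have hr1' : (B r 1 : ℚ) ≠ 0 := by exact_mod_cast hr1
  refine ⟨r, s, (B r 0, B r 1), hr0, hr1, ⟨1, one_pos, by simp, by simp⟩,
    (B s ℓ : ℚ) / B r ℓ, div_neg_of_neg_of_pos (by exact_mod_cast hs) (by exact_mod_cast hr), ?_⟩
  fin_cases ℓ
  · exact ⟨by simp [hr0'], by simp only [Fin.zero_eta]; field_simp; linear_combination hdet⟩
  · exact ⟨by simp only [Fin.mk_one]; field_simp; linear_combination -hdet, by simp [hr1']⟩

/-- Let `B = (b_{iℓ})` be an `n × 2` integer matrix of rank `2` with both column sums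
zero, and let `h_1, h_2 ∈ ℚ[x_1, …, x_n][t]` be as above.  Then `h_1` and `h_2` have a
nonconstant common factor as polynomials in `t` over the field of fractions of
`ℚ[x_1, …, x_n]` if and only if there exist indices `r, s` and a vector `v ∈ ℤ²` with
both coordinates nonzero such that `b_r` is a positive rational multiple of `v` and
`b_s` is a negative rational multiple of `v` (i.e. there is a relevant line which is
not a coordinate axis). -/
theorem common_factor_iff_relevant_line {n : ℕ} (B : Matrix (Fin n) (Fin 2) ℤ)
    (hrank : B.rank = 2) (hsum : ∀ ℓ : Fin 2, ∑ i, B i ℓ = 0) :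
    (∃ p : Polynomial (FractionRing (MvPolynomial (Fin n) ℚ)),
        0 < p.degree ∧
        p ∣ (specH B 0).map (algebraMap (MvPolynomial (Fin n) ℚ)
              (FractionRing (MvPolynomial (Fin n) ℚ))) ∧
        p ∣ (specH B 1).map (algebraMap (MvPolynomial (Fin n) ℚ)
              (FractionRing (MvPolynomial (Fin n) ℚ)))) ↔
    (∃ (r s : Fin n) (v : ℤ × ℤ), v.1 ≠ 0 ∧ v.2 ≠ 0 ∧
        (∃ p : ℚ, 0 < p ∧ (B r 0 : ℚ) = p * (v.1 : ℚ) ∧ (B r 1 : ℚ) = p * (v.2 : ℚ)) ∧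
        (∃ q : ℚ, q < 0 ∧ (B s 0 : ℚ) = q * (v.1 : ℚ) ∧ (B s 1 : ℚ) = q * (v.2 : ℚ))) := by
  constructor
  · rintro ⟨p, hdeg, hp0, hp1⟩
    let K := FractionRing (MvPolynomial (Fin n) ℚ)
    let L := AlgebraicClosure K
    obtain ⟨a, ha⟩ := IsAlgClosed.exists_aeval_eq_zero L p hdeg.ne'
    let f : MvPolynomial (Fin n) ℚ →ₐ[ℚ] L := (Algebra.ofId K L).restrictScalars ℚ |>.comp
      (Algebra.ofId (MvPolynomial (Fin n) ℚ) K |>.restrictScalars ℚ)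
    have hf : Function.Injective f := (algebraMap K L).injective.comp
      (IsFractionRing.injective (MvPolynomial (Fin n) ℚ) K)
    let x : Fin n → L := fun i => f (MvPolynomial.X i)
    have hx : AlgebraicIndependent ℚ x :=
      AlgebraicIndependent.map' (f := f) (MvPolynomial.algebraicIndependent_X (Fin n) ℚ) hf
    let M : Fin 2 → L := fun ℓ => ∏ i, x i ^ B i ℓ
    have hM : AlgebraicIndependent ℚ M :=
      hx.prod_zpow B (B.mulVec_injective_of_rank_eq (by simpa using hrank))
    let u : Fin n → L := fun i => (B i 0 : L) + B i 1 * a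
    have key : ∀ ℓ, p ∣ (specH B ℓ).map (algebraMap (MvPolynomial (Fin n) ℚ) K) →
        M ℓ = (∏ i, u i ^ B i ℓ)⁻¹ ∨ ∃ r s, 0 < B r ℓ ∧ B s ℓ < 0 ∧ u r = 0 ∧ u s = 0 := by
      intro ℓ hp
      have hroot : (specH B ℓ).eval₂ (f : MvPolynomial (Fin n) ℚ →+* L) a = 0 := by
        have h := aeval_eq_zero_of_dvd_aeval_eq_zero hp ha
        rw [aeval_def, eval₂_map] at h
        exact h
      rw [eval₂_specH, sub_eq_zero] at hroot
      rcases prod_zpow_eq_one_or_exists_eq_zero (fun i => u i * x i) (fun i => B i ℓ) hroot with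
        h | ⟨r, s, hr, hs, hr0, hs0⟩
      · left
        simp only [mul_zpow, Finset.prod_mul_distrib] at h
        exact eq_inv_of_mul_eq_one_right h
      · exact Or.inr ⟨r, s, hr, hs, (mul_eq_zero.1 hr0).resolve_right (hx.ne_zero r),
          (mul_eq_zero.1 hs0).resolve_right (hx.ne_zero s)⟩
    have hmem : ∀ (t : L) ℓ, (∀ i, u i ∈ IntermediateField.adjoin ℚ {t}) →
        M ℓ = (∏ i, u i ^ B i ℓ)⁻¹ → M ℓ ∈ IntermediateField.adjoin ℚ {t} := by
      intro t ℓ hu h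
      rw [h]
      exact inv_mem (prod_mem fun i _ => zpow_mem (hu i) _)
    have hu : ∀ i, u i ∈ IntermediateField.adjoin ℚ {a} := fun i =>
      add_mem (intCast_mem _ _) (mul_mem (intCast_mem _ _)
        (IntermediateField.mem_adjoin_simple_self ℚ a))
    rcases key 0 hp0 with h0 | ⟨r, s, hr, hs, hur, hus⟩
    · rcases key 1 hp1 with h1 | ⟨r, s, hr, hs, hur, hus⟩
      · refine absurd (fun j => ?_) (hM.not_forall_mem_adjoin_singleton a)
        fin_cases j
        · exact hmem a 0 hu h0
        · exact hmem a 1 hu h1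
      · refine exists_opposite_of_common_zero B 1 a hr hs (fun hr0 => ?_) hr.ne' hur hus
        have ha0 : a = 0 := by
          have : (B r 1 : L) ≠ 0 := by exact_mod_cast hr.ne'
          simpa [u, hr0, this, hr.ne'] using hur
        refine absurd (fun j => ?_) (hM.not_forall_mem_adjoin_singleton (M 1))
        fin_cases j
        · refine hmem (M 1) 0 (fun i => ?_) h0
          simp only [u, ha0, mul_zero, add_zero]
          exact intCast_mem _ _
        · exact IntermediateField.mem_adjoin_simple_self ℚ (M 1)
    · refine exists_opposite_of_common_zero B 0 a hr hs hr.ne' (fun hr1 => ?_) hur hus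
      have : (B r 0 : L) ≠ 0 := by exact_mod_cast hr.ne'
      simp [u, hr1, hr.ne'] at hur
  · rintro ⟨r, s, v, hv1, hv2, ⟨p, hp, hr0, hr1⟩, q, hq, hs0, hs1⟩
    let g : Polynomial (MvPolynomial (Fin n) ℚ) :=
      C (MvPolynomial.C (v.1 : ℚ)) + C (MvPolynomial.C (v.2 : ℚ)) * X
    have hg : ∀ (i : Fin n) (c : ℚ), (B i 0 : ℚ) = c * v.1 → (B i 1 : ℚ) = c * v.2 →
        g ∣ C (MvPolynomial.C (B i 0 : ℚ)) + C (MvPolynomial.C (B i 1 : ℚ)) * X := by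
      intro i c h0 h1
      refine ⟨C (MvPolynomial.C c), ?_⟩
      rw [h0, h1]
      simp only [g, map_mul]
      ring
    have hdvd : ∀ (ℓ : Fin 2) (w : ℤ), w ≠ 0 → (B r ℓ : ℚ) = p * w → (B s ℓ : ℚ) = q * w →
        g ∣ specH B ℓ := by
      intro ℓ w hw hr hs
      rcases lt_or_gt_of_ne hw with hneg | hpos
      · have hw' : (w : ℚ) < 0 := by exact_mod_cast hneg
        have h1 : (B r ℓ : ℚ) < 0 := hr ▸ mul_neg_of_pos_of_neg hp hw'
        have h2 : (0 : ℚ) < B s ℓ := hs ▸ mul_pos_of_neg_of_neg hq hw'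
        exact linear_dvd_specH B ℓ g (by exact_mod_cast h2) (by exact_mod_cast h1)
          (hg s q hs0 hs1) (hg r p hr0 hr1)
      · have hw' : (0 : ℚ) < w := by exact_mod_cast hpos
        have h1 : (0 : ℚ) < B r ℓ := hr ▸ mul_pos hp hw'
        have h2 : (B s ℓ : ℚ) < 0 := hs ▸ mul_neg_of_neg_of_pos hq hw'
        exact linear_dvd_specH B ℓ g (by exact_mod_cast h1) (by exact_mod_cast h2)
          (hg r p hr0 hr1) (hg s q hs0 hs1)
    refine ⟨g.map (algebraMap _ _), ?_, Polynomial.map_dvd _ (hdvd 0 v.1 hv1 hr0 hs0),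
      Polynomial.map_dvd _ (hdvd 1 v.2 hv2 hr1 hs1)⟩
    rw [degree_map_eq_of_injective (IsFractionRing.injective _ _)]
    have : g.degree = 1 := by
      rw [show g = C (MvPolynomial.C (v.2 : ℚ)) * X + C (MvPolynomial.C (v.1 : ℚ)) from
        add_comm _ _]
      exact degree_linear (by simpa using hv2)
    rw [this]
    exact one_pos
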